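/- Amortization collapse of the relative entropy for classical-quantum channels: let N, M : X → B be classical-quantum channels determined by finite families of states {ν_B^x}_{x∈X} and {μ_B^x}_{x∈X}. Then the amortized channel divergence for the quantum relative entropy satisfies D^A(N‖M) = max_{x∈X} D(ν_B^x ‖ μ_B^x). -/

import Mathlib

open scoped BigOperators ComplexOrder

noncomputable section

attribute [local instance] Classical.propDecidable

/-- A density matrix (quantum state): positive semidefinite with unit trace. -/
def IsDensity {ι : Type} [Fintype ι] (ρ : Matrix ι ι ℂ) : Prop :=
  ρ.PosSemidef ∧ ρ.trace = 1

/-- The map `id_R ⊗ Φ` (for linear `Φ`), defined blockwise. -/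
def idTensor {R ι κ : Type} (Φ : Matrix ι ι ℂ → Matrix κ κ ℂ)
    (X : Matrix (R × ι) (R × ι) ℂ) : Matrix (R × κ) (R × κ) ℂ :=
  fun p q => Φ (fun a b => X (p.1, a) (q.1, b)) p.2 q.2

/-- The map `Φ ⊗ id_E` (for linear `Φ`), defined blockwise. -/
def tensorId {ι κ E : Type} (Φ : Matrix ι ι ℂ → Matrix κ κ ℂ)
    (X : Matrix (ι × E) (ι × E) ℂ) : Matrix (κ × E) (κ × E) ℂ :=
  fun p q => Φ (fun a b => X (a, p.2) (b, q.2)) p.1 q.1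

/-- A quantum channel: linear, trace preserving, and completely positive. -/
structure IsChannel {ι κ : Type} [Fintype ι] [Fintype κ]
    (Φ : Matrix ι ι ℂ → Matrix κ κ ℂ) : Prop where
  linear : IsLinearMap ℂ Φ
  tracePres : ∀ X, (Φ X).trace = X.trace
  compPos : ∀ (k : ℕ) (X : Matrix (Fin k × ι) (Fin k × ι) ℂ),
      X.PosSemidef → (idTensor Φ X).PosSemidef

/-- A family of divergences, one for every finite dimension. -/
abbrev DivFam : Type 1 :=
  ∀ (ι : Type) [Fintype ι] [DecidableEq ι], Matrix ι ι ℂ → Matrix ι ι ℂ → EReal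

/-- Data processing: a generalized divergence does not increase under channels. -/
def DivDataProcessing (D : DivFam) : Prop :=
  ∀ (ι κ : Type) [Fintype ι] [DecidableEq ι] [Fintype κ] [DecidableEq κ]
    (Φ : Matrix ι ι ℂ → Matrix κ κ ℂ), IsChannel Φ →
    ∀ ρ σ : Matrix ι ι ℂ, IsDensity ρ → IsDensity σ →
      D κ (Φ ρ) (Φ σ) ≤ D ι ρ σ

/-- Faithfulness: `D(ρ‖ρ) ≤ 0` for every state `ρ`. -/
def DivFaithful (D : DivFam) : Prop :=
  ∀ (ι : Type) [Fintype ι] [DecidableEq ι] (ρ : Matrix ι ι ℂ),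
    IsDensity ρ → D ι ρ ρ ≤ 0

/-- Strong faithfulness: `D(ρ‖σ) = 0` iff `ρ = σ`. -/
def DivStronglyFaithful (D : DivFam) : Prop :=
  ∀ (ι : Type) [Fintype ι] [DecidableEq ι] (ρ σ : Matrix ι ι ℂ),
    IsDensity ρ → IsDensity σ → (D ι ρ σ = 0 ↔ ρ = σ)

/-- The generalized channel divergence `D(N‖M)`. -/
def channelDiv (D : DivFam) {ι κ : Type} [Fintype ι] [DecidableEq ι] [Fintype κ] [DecidableEq κ]
    (N M : Matrix ι ι ℂ → Matrix κ κ ℂ) : EReal :=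
  ⨆ (R : ℕ) (ρ : Matrix (Fin R × ι) (Fin R × ι) ℂ) (_ : IsDensity ρ),
    D (Fin R × κ) (idTensor N ρ) (idTensor M ρ)

/-- The amortized channel divergence `D^𝒜(N‖M)`. -/
def amortizedDiv (D : DivFam) {ι κ : Type} [Fintype ι] [DecidableEq ι] [Fintype κ] [DecidableEq κ]
    (N M : Matrix ι ι ℂ → Matrix κ κ ℂ) : EReal :=
  ⨆ (R : ℕ) (ρ : Matrix (Fin R × ι) (Fin R × ι) ℂ) (σ : Matrix (Fin R × ι) (Fin R × ι) ℂ)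
    (_ : IsDensity ρ) (_ : IsDensity σ),
      D (Fin R × κ) (idTensor N ρ) (idTensor M σ) - D (Fin R × ι) ρ σ

/-- Apply a real function to a Hermitian matrix via the spectral decomposition. -/
def hermFun {ι : Type} [Fintype ι] [DecidableEq ι] (f : ℝ → ℝ) (A : Matrix ι ι ℂ) :
    Matrix ι ι ℂ :=
  if hA : A.IsHermitian then
    (hA.eigenvectorUnitary : Matrix ι ι ℂ) *
      Matrix.diagonal (fun i => (f (hA.eigenvalues i) : ℂ)) *
      star (hA.eigenvectorUnitary : Matrix ι ι ℂ)
  else 0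

/-- Real matrix power via spectral calculus, with the generalized-inverse convention `0 ↦ 0`. -/
def matPow {ι : Type} [Fintype ι] [DecidableEq ι] (A : Matrix ι ι ℂ) (r : ℝ) : Matrix ι ι ℂ :=
  hermFun (fun x => if x = 0 then 0 else Real.rpow x r) A

/-- Matrix base-2 logarithm via spectral calculus, taken on the support. -/
def matLog2 {ι : Type} [Fintype ι] [DecidableEq ι] (A : Matrix ι ι ℂ) : Matrix ι ι ℂ :=
  hermFun (fun x => if x = 0 then 0 else Real.logb 2 x) A

/-- The projection onto the support of a Hermitian matrix. -/
def suppProj {ι : Type} [Fintype ι] [DecidableEq ι] (A : Matrix ι ι ℂ) : Matrix ι ι ℂ :=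
  hermFun (fun x => if x = 0 then 0 else 1) A

/-- `supp ρ ⊆ supp σ`, expressed (for Hermitian matrices) as kernel containment
`ker σ ⊆ ker ρ`. -/
def suppLE {ι : Type} [Fintype ι] (ρ σ : Matrix ι ι ℂ) : Prop :=
  ∀ v : ι → ℂ, σ.mulVec v = 0 → ρ.mulVec v = 0

/-- The quantum relative entropy `D(ρ‖σ) = Tr[ρ(log₂ρ − log₂σ)]`,
`+∞` if the support condition fails. -/
def relEnt {ι : Type} [Fintype ι] [DecidableEq ι] (ρ σ : Matrix ι ι ℂ) : EReal :=
  if suppLE ρ σ then (((ρ * (matLog2 ρ - matLog2 σ)).trace).re : EReal) else ⊤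

/-- `−log₂ x` as an extended real, with `−log₂ 0 = +∞`. -/
def negLog2 (x : ℝ) : EReal :=
  if x ≤ 0 then ⊤ else ((-Real.logb 2 x : ℝ) : EReal)

/-- The max-relative entropy `D_max(ρ‖σ) = inf{λ : ρ ≤ 2^λ σ}` (Loewner order). -/
def Dmax {ι : Type} [Fintype ι] (ρ σ : Matrix ι ι ℂ) : EReal :=
  ⨅ (l : ℝ) (_ : (((2 : ℝ) ^ l) • σ - ρ).PosSemidef), (l : EReal)

/-- The sandwiched Rényi divergence `D̃_α`. -/
def sandRenyi {ι : Type} [Fintype ι] [DecidableEq ι] (α : ℝ) (ρ σ : Matrix ι ι ℂ) : EReal :=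
  if α = 1 then relEnt ρ σ
  else if 1 < α ∧ ¬ suppLE ρ σ then ⊤
  else if α < 1 ∧ (ρ * σ).trace = 0 then ⊤
  else ((((α - 1)⁻¹ *
      Real.logb 2
        (((matPow (matPow σ ((1 - α) / (2 * α)) * ρ * matPow σ ((1 - α) / (2 * α))) α).trace).re)) :
        ℝ) : EReal)

/-- The Petz–Rényi divergence `D_α`. -/
def petzRenyi {ι : Type} [Fintype ι] [DecidableEq ι] (α : ℝ) (ρ σ : Matrix ι ι ℂ) : EReal :=
  if α = 0 then negLog2 (((suppProj ρ * σ).trace).re)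
  else if α = 1 then relEnt ρ σ
  else if 1 < α ∧ ¬ suppLE ρ σ then ⊤
  else if α < 1 ∧ (ρ * σ).trace = 0 then ⊤
  else ((((α - 1)⁻¹ * Real.logb 2 (((matPow ρ α * matPow σ (1 - α)).trace).re)) : ℝ) : EReal)

/-- The trace norm `‖X‖₁ = Tr √(XᴴX)`. -/
def traceNorm {ι : Type} [Fintype ι] [DecidableEq ι] (X : Matrix ι ι ℂ) : ℝ :=
  ((matPow (X.conjTranspose * X) (1/2 : ℝ)).trace).re

/-- The fidelity `F(ρ,σ) = ‖√ρ√σ‖₁²`. -/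
def matFidelity {ι : Type} [Fintype ι] [DecidableEq ι] (ρ σ : Matrix ι ι ℂ) : ℝ :=
  (traceNorm (matPow ρ (1/2 : ℝ) * matPow σ (1/2 : ℝ))) ^ 2

def relEntFam : DivFam := fun _ _ _ ρ σ => relEnt ρ σ
def DmaxFam : DivFam := fun _ _ _ ρ σ => Dmax ρ σ
def sandFam (α : ℝ) : DivFam := fun _ _ _ ρ σ => sandRenyi α ρ σ
def petzFam (α : ℝ) : DivFam := fun _ _ _ ρ σ => petzRenyi α ρ σ
/-- `D̃_{1/2}(ρ‖σ) = −log₂ F(ρ,σ)` as a divergence family. -/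
def fidDivFam : DivFam := fun _ _ _ ρ σ => negLog2 (matFidelity ρ σ)

/-- The classical-quantum state `Σ_x p(x) |x⟩⟨x| ⊗ ρ^x`. -/
def cqState {X ι : Type} [DecidableEq X] (p : X → ℝ) (ρ : X → Matrix ι ι ℂ) :
    Matrix (X × ι) (X × ι) ℂ :=
  fun a b => if a.1 = b.1 then (p a.1 : ℂ) * ρ a.1 a.2 b.2 else 0

/-- The direct-sum property of a generalized divergence on classical-quantum states. -/
def DivDirectSum (D : DivFam) : Prop :=
  ∀ (X ι : Type) [Fintype X] [DecidableEq X] [Fintype ι] [DecidableEq ι]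
    (p : X → ℝ), (∀ x, 0 ≤ p x) → (∑ x, p x = 1) →
    ∀ (ρ σ : X → Matrix ι ι ℂ), (∀ x, IsDensity (ρ x)) → (∀ x, IsDensity (σ x)) →
      D (X × ι) (cqState p ρ) (cqState p σ) = ∑ x, (p x : EReal) * D ι (ρ x) (σ x)

/-- The Kronecker (tensor) product of square matrices. -/
def mkron {ι E : Type} (A : Matrix ι ι ℂ) (B : Matrix E E ℂ) : Matrix (ι × E) (ι × E) ℂ :=
  fun p q => A p.1 q.1 * B p.2 q.2

/-- Sub-additivity of a divergence with respect to tensor-product states. -/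
def DivSubAdditive (D : DivFam) : Prop :=
  ∀ (ι E : Type) [Fintype ι] [DecidableEq ι] [Fintype E] [DecidableEq E]
    (ρ σ : Matrix ι ι ℂ) (ω τ : Matrix E E ℂ),
    IsDensity ρ → IsDensity σ → IsDensity ω → IsDensity τ →
      D (ι × E) (mkron ρ ω) (mkron σ τ) ≤ D ι ρ σ + D E ω τ

/-- The classical-quantum channel `ρ ↦ Σ_x ⟨x|ρ|x⟩ ν^x`. -/
def cqChannel {X κ : Type} [Fintype X] [Fintype κ] (ν : X → Matrix κ κ ℂ) :
    Matrix X X ℂ → Matrix κ κ ℂ :=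
  fun ρ => ∑ x, ρ x x • ν x

/-- The maximally entangled state of Schmidt rank `|ι|` on `ι × ι`. -/
def maxEnt (ι : Type) [Fintype ι] [DecidableEq ι] : Matrix (ι × ι) (ι × ι) ℂ :=
  fun p q => if p.1 = p.2 ∧ q.1 = q.2 then ((Fintype.card ι : ℂ))⁻¹ else 0

/-- An `(m+1)`-round adaptive channel discrimination protocol: registers `R_0, …, R_m`,
a shared initial state, adaptive channels between channel uses, and a final measurement. -/
structure Protocol (ι κ : Type) [Fintype ι] [DecidableEq ι] [Fintype κ] [DecidableEq κ]
    (m : ℕ) where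
  r : ℕ → ℕ
  init : Matrix (Fin (r 0) × ι) (Fin (r 0) × ι) ℂ
  init_density : IsDensity init
  adapt : ∀ i : ℕ, Matrix (Fin (r i) × κ) (Fin (r i) × κ) ℂ →
      Matrix (Fin (r (i + 1)) × ι) (Fin (r (i + 1)) × ι) ℂ
  adapt_channel : ∀ i, i < m → IsChannel (adapt i)
  meas : Matrix (Fin (r m) × κ) (Fin (r m) × κ) ℂ
  meas_psd : meas.PosSemidef
  meas_le_one : ((1 : Matrix (Fin (r m) × κ) (Fin (r m) × κ) ℂ) - meas).PosSemidef

namespace Protocol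

variable {ι κ : Type} [Fintype ι] [DecidableEq ι] [Fintype κ] [DecidableEq κ] {m : ℕ}

/-- The state on `R_i ⊗ A` just before the `(i+1)`-st channel use, when the channel is `Ch`. -/
def evolve (P : Protocol ι κ m) (Ch : Matrix ι ι ℂ → Matrix κ κ ℂ) :
    (i : ℕ) → Matrix (Fin (P.r i) × ι) (Fin (P.r i) × ι) ℂ
  | 0 => P.init
  | (i + 1) => P.adapt i (idTensor Ch (P.evolve Ch i))

/-- The final state on `R_m ⊗ B` after all `m + 1` channel uses. -/
def final (P : Protocol ι κ m) (Ch : Matrix ι ι ℂ → Matrix κ κ ℂ) :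
    Matrix (Fin (P.r m) × κ) (Fin (P.r m) × κ) ℂ :=
  idTensor Ch (P.evolve Ch m)

/-- The probability of accepting (deciding for the null hypothesis). -/
def acceptProb (P : Protocol ι κ m) (Ch : Matrix ι ι ℂ → Matrix κ κ ℂ) : ℝ :=
  ((P.meas * P.final Ch).trace).re

/-- The type I error probability `Tr[(I − Q) ρ'⁽ⁿ⁾]`. -/
def typeI (P : Protocol ι κ m) (N : Matrix ι ι ℂ → Matrix κ κ ℂ) : ℝ :=
  ((((1 : Matrix (Fin (P.r m) × κ) (Fin (P.r m) × κ) ℂ) - P.meas) * P.final N).trace).re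

/-- The type II error probability `Tr[Q τ'⁽ⁿ⁾]`. -/
def typeII (P : Protocol ι κ m) (M : Matrix ι ι ℂ → Matrix κ κ ℂ) : ℝ :=
  ((P.meas * P.final M).trace).re

end Protocol

/-- The binary (classical) state `diag(p, 1−p)`. -/
def binState (p : ℝ) : Matrix (Fin 2) (Fin 2) ℂ :=
  Matrix.diagonal (fun i => if i = 0 then (p : ℂ) else ((1 - p : ℝ) : ℂ))

/-- The binary entropy `h₂(ε)`. -/
def h2 (ε : ℝ) : ℝ := -(ε * Real.logb 2 ε) - (1 - ε) * Real.logb 2 (1 - ε)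

/-- `ζ_n(ε, N, M)` with `n = m + 1`: the optimal type II error exponent among all
`(m+1)`-round adaptive protocols with type I error at most `ε`. -/
def steinExp {ι κ : Type} [Fintype ι] [DecidableEq ι] [Fintype κ] [DecidableEq κ]
    (N M : Matrix ι ι ℂ → Matrix κ κ ℂ) (m : ℕ) (ε : ℝ) : EReal :=
  ⨆ (P : Protocol ι κ m) (_ : P.typeI N ≤ ε),
    (((m + 1 : ℝ))⁻¹ : EReal) * negLog2 (P.typeII M)

/-- Partial trace over the (left) reference system. -/
def ptraceLeft {R ι : Type} [Fintype R] (ψ : Matrix (R × ι) (R × ι) ℂ) : Matrix ι ι ℂ :=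
  fun a b => ∑ r, ψ (r, a) (r, b)

/-- The energy-constrained generalized channel divergence. -/
def eChannelDiv (D : DivFam) {ι κ : Type} [Fintype ι] [DecidableEq ι] [Fintype κ] [DecidableEq κ]
    (H : Matrix ι ι ℂ) (E : ℝ) (N M : Matrix ι ι ℂ → Matrix κ κ ℂ) : EReal :=
  ⨆ (R : ℕ) (ψ : Matrix (Fin R × ι) (Fin R × ι) ℂ) (_ : IsDensity ψ)
    (_ : ((H * ptraceLeft ψ).trace).re ≤ E),
      D (Fin R × κ) (idTensor N ψ) (idTensor M ψ)

/-- The energy-constrained amortized channel divergence. -/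
def eAmortizedDiv (D : DivFam) {ι κ : Type} [Fintype ι] [DecidableEq ι] [Fintype κ] [DecidableEq κ]
    (H : Matrix ι ι ℂ) (E : ℝ) (N M : Matrix ι ι ℂ → Matrix κ κ ℂ) : EReal :=
  ⨆ (R : ℕ) (ρ : Matrix (Fin R × ι) (Fin R × ι) ℂ) (σ : Matrix (Fin R × ι) (Fin R × ι) ℂ)
    (_ : IsDensity ρ) (_ : IsDensity σ)
    (_ : ((H * ptraceLeft ρ).trace).re ≤ E) (_ : ((H * ptraceLeft σ).trace).re ≤ E),
      D (Fin R × κ) (idTensor N ρ) (idTensor M σ) - D (Fin R × ι) ρ σ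

/-- `sup_α(ρ/σ)`: supremum of `Tr[Λρ]/Tr[Λσ]` over Hermitian `Λ` with `α⁻¹ I ≤ Λ ≤ I`. -/
def hilbertSup {ι : Type} [Fintype ι] [DecidableEq ι] (α : ℝ) (ρ σ : Matrix ι ι ℂ) : ℝ :=
  sSup { t : ℝ | ∃ Λ : Matrix ι ι ℂ, Λ.IsHermitian ∧
    (Λ - (α⁻¹ : ℝ) • (1 : Matrix ι ι ℂ)).PosSemidef ∧
    ((1 : Matrix ι ι ℂ) - Λ).PosSemidef ∧
    t = ((Λ * ρ).trace).re / ((Λ * σ).trace).re }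

/-- The Hilbert `α`-divergence `H_α(ρ‖σ)`, with `H₁(ρ‖σ) = ‖ρ−σ‖₁ / (2 ln 2)`. -/
def hilbertDiv {ι : Type} [Fintype ι] [DecidableEq ι] (α : ℝ) (ρ σ : Matrix ι ι ℂ) : ℝ :=
  if α = 1 then (2 * Real.log 2)⁻¹ * traceNorm (ρ - σ)
  else (α / (α - 1)) * Real.logb 2 (hilbertSup α ρ σ)

open Matrix in
/-- `U` is unitary and diagonalizes `A`, with eigenvalues `p`. -/
structure IsSpectral {ι : Type} [Fintype ι] [DecidableEq ι] (A U : Matrix ι ι ℂ) (p : ι → ℝ) :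
    Prop where
  star_mul : Uᴴ * U = 1
  mul_star : U * Uᴴ = 1
  eq : A = U * diagonal (fun i => (p i : ℂ)) * Uᴴ

section Spectral

open Matrix

variable {ι : Type} [Fintype ι] [DecidableEq ι]

lemma Matrix.IsHermitian.isSpectral {A : Matrix ι ι ℂ} (hA : A.IsHermitian) :
    IsSpectral A (hA.eigenvectorUnitary : Matrix ι ι ℂ) hA.eigenvalues where
  star_mul := Unitary.coe_star_mul_self hA.eigenvectorUnitary
  mul_star := Unitary.coe_mul_star_self hA.eigenvectorUnitary
  eq := by
    have h := hA.spectral_theorem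
    rw [Unitary.conjStarAlgAut_apply] at h
    exact h

lemma Matrix.PosSemidef.exists_isSpectral {A : Matrix ι ι ℂ} (hA : A.PosSemidef) :
    ∃ U p, IsSpectral A U p ∧ ∀ i, 0 ≤ p i :=
  ⟨_, _, hA.1.isSpectral, hA.eigenvalues_nonneg⟩

lemma IsSpectral.isHermitian {A U : Matrix ι ι ℂ} {p : ι → ℝ} (h : IsSpectral A U p) :
    A.IsHermitian := by
  have hd : (diagonal (fun i => (p i : ℂ)))ᴴ = diagonal (fun i => (p i : ℂ)) := by
    rw [diagonal_conjTranspose]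
    congr 1
    ext i
    simp
  rw [IsHermitian, h.eq]
  simp only [conjTranspose_mul, conjTranspose_conjTranspose, hd, Matrix.mul_assoc]

lemma IsSpectral.intertwine (f : ℝ → ℝ) {A U V : Matrix ι ι ℂ} {p q : ι → ℝ}
    (hU : IsSpectral A U p) (hV : IsSpectral A V q) :
    U * diagonal (fun i => (f (p i) : ℂ)) * Uᴴ = V * diagonal (fun i => (f (q i) : ℂ)) * Vᴴ := by
  have h1 : diagonal (fun i => (p i : ℂ)) * (Uᴴ * V) = (Uᴴ * V) * diagonal (fun i => (q i : ℂ)) := by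
    calc diagonal (fun i => (p i : ℂ)) * (Uᴴ * V)
        = (Uᴴ * U) * diagonal (fun i => (p i : ℂ)) * Uᴴ * V := by
          rw [hU.star_mul, Matrix.one_mul, Matrix.mul_assoc]
      _ = Uᴴ * (U * diagonal (fun i => (p i : ℂ)) * Uᴴ) * V := by simp only [Matrix.mul_assoc]
      _ = Uᴴ * (V * diagonal (fun i => (q i : ℂ)) * Vᴴ) * V := by rw [← hU.eq, ← hV.eq]
      _ = Uᴴ * V * diagonal (fun i => (q i : ℂ)) * (Vᴴ * V) := by simp only [Matrix.mul_assoc]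
      _ = _ := by rw [hV.star_mul, Matrix.mul_one]
  have h2 : diagonal (fun i => (f (p i) : ℂ)) * (Uᴴ * V)
      = (Uᴴ * V) * diagonal (fun i => (f (q i) : ℂ)) := by
    ext i j
    have h3 := congrFun (congrFun h1 i) j
    rw [diagonal_mul, mul_diagonal] at h3 ⊢
    by_cases hz : (Uᴴ * V) i j = 0
    · simp [hz]
    · have : p i = q j := by
        rw [mul_comm] at h3
        exact_mod_cast mul_left_cancel₀ hz h3
      rw [this, mul_comm]
  calc U * diagonal (fun i => (f (p i) : ℂ)) * Uᴴ
      = U * (diagonal (fun i => (f (p i) : ℂ)) * (Uᴴ * V)) * Vᴴ := by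
        simp only [Matrix.mul_assoc, hV.mul_star, Matrix.mul_one]
    _ = (U * Uᴴ) * V * diagonal (fun i => (f (q i) : ℂ)) * Vᴴ := by
        rw [h2]; simp only [Matrix.mul_assoc]
    _ = _ := by rw [hU.mul_star, Matrix.one_mul]

lemma IsSpectral.hermFun_eq (f : ℝ → ℝ) {A U : Matrix ι ι ℂ} {p : ι → ℝ} (h : IsSpectral A U p) :
    hermFun f A = U * diagonal (fun i => (f (p i) : ℂ)) * Uᴴ := by
  rw [hermFun, dif_pos h.isHermitian]
  exact h.isHermitian.isSpectral.intertwine f h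

lemma trace_conj_diagonal_mul (U V : Matrix ι ι ℂ) (a b : ι → ℝ) :
    (U * diagonal (fun i => (a i : ℂ)) * Uᴴ * (V * diagonal (fun i => (b i : ℂ)) * Vᴴ)).trace
      = ((∑ i, ∑ j, Complex.normSq ((Uᴴ * V) i j) * (a i * b j) : ℝ) : ℂ) := by
  have h1 : (U * diagonal (fun i => (a i : ℂ)) * Uᴴ *
        (V * diagonal (fun i => (b i : ℂ)) * Vᴴ)).trace
      = ((diagonal (fun i => (a i : ℂ)) * (Uᴴ * V)) *
        (diagonal (fun i => (b i : ℂ)) * (Uᴴ * V)ᴴ)).trace := by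
    rw [Matrix.mul_assoc, Matrix.mul_assoc, Matrix.trace_mul_comm, conjTranspose_mul,
      conjTranspose_conjTranspose]
    simp only [Matrix.mul_assoc]
  rw [h1]
  simp only [Matrix.trace, diag_apply, Matrix.mul_apply (M := diagonal _ * _), diagonal_mul,
    conjTranspose_apply]
  push_cast
  refine Finset.sum_congr rfl fun i _ => Finset.sum_congr rfl fun j _ => ?_
  rw [Complex.normSq_eq_conj_mul_self, starRingEnd_apply]
  ring

lemma sum_normSq_row {C : Matrix ι ι ℂ} (hC : C * Cᴴ = 1) (i : ι) :
    ∑ j, Complex.normSq (C i j) = 1 := by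
  have h := congrFun (congrFun hC i) i
  rw [Matrix.mul_apply, one_apply_eq] at h
  have : ((∑ j, Complex.normSq (C i j) : ℝ) : ℂ) = 1 := by
    rw [← h]
    push_cast
    refine Finset.sum_congr rfl fun j _ => ?_
    rw [conjTranspose_apply, Complex.normSq_eq_conj_mul_self, starRingEnd_apply, mul_comm]
  exact_mod_cast this

lemma IsSpectral.overlap_unitary {A B U V : Matrix ι ι ℂ} {p q : ι → ℝ} (hU : IsSpectral A U p)
    (hV : IsSpectral B V q) : (Uᴴ * V) * (Uᴴ * V)ᴴ = 1 := by
  calc (Uᴴ * V) * (Uᴴ * V)ᴴ = Uᴴ * (V * Vᴴ) * U := by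
        simp only [conjTranspose_mul, conjTranspose_conjTranspose, Matrix.mul_assoc]
    _ = 1 := by rw [hV.mul_star, Matrix.mul_one, hU.star_mul]

/-- The trace `Tr[ρ(log₂ρ − log₂σ)]`, ignoring the support condition. -/
def relTrace (ρ σ : Matrix ι ι ℂ) : ℝ := ((ρ * (matLog2 ρ - matLog2 σ)).trace).re

lemma IsSpectral.matLog2_eq {A U : Matrix ι ι ℂ} {p : ι → ℝ} (h : IsSpectral A U p) :
    matLog2 A = U * diagonal (fun i => (Real.logb 2 (p i) : ℂ)) * Uᴴ := by
  have : (fun x : ℝ => if x = 0 then 0 else Real.logb 2 x) = Real.logb 2 := by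
    ext x
    split_ifs with hx <;> simp [hx]
  rw [matLog2, this, h.hermFun_eq]

lemma IsSpectral.trace_eq {A U : Matrix ι ι ℂ} {p : ι → ℝ} (h : IsSpectral A U p) :
    A.trace = ((∑ i, p i : ℝ) : ℂ) := by
  rw [h.eq, Matrix.trace_mul_comm, ← Matrix.mul_assoc, h.star_mul, Matrix.one_mul, trace_diagonal]
  push_cast
  rfl

lemma relTrace_eq_sum {ρ σ U V : Matrix ι ι ℂ} {p q : ι → ℝ} (hU : IsSpectral ρ U p)
    (hV : IsSpectral σ V q) :
    relTrace ρ σ = ∑ i, ∑ j, Complex.normSq ((Uᴴ * V) i j) *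
      (p i * (Real.logb 2 (p i) - Real.logb 2 (q j))) := by
  have h1 : (ρ * matLog2 ρ).trace = ((∑ i, p i * Real.logb 2 (p i) : ℝ) : ℂ) := by
    have : ρ * matLog2 ρ = U * diagonal (fun i => ((p i * Real.logb 2 (p i) : ℝ) : ℂ)) * Uᴴ := by
      rw [hU.matLog2_eq]
      nth_rw 1 [hU.eq]
      calc _ = U * diagonal (fun i => (p i : ℂ)) * (Uᴴ * U) *
            diagonal (fun i => (Real.logb 2 (p i) : ℂ)) * Uᴴ := by simp only [Matrix.mul_assoc]
        _ = _ := by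
          rw [hU.star_mul, Matrix.mul_one, Matrix.mul_assoc U, diagonal_mul_diagonal]
          push_cast
          rfl
    exact (IsSpectral.mk hU.star_mul hU.mul_star this).trace_eq
  have h2 : (ρ * matLog2 σ).trace = ((∑ i, ∑ j, Complex.normSq ((Uᴴ * V) i j) *
      (p i * Real.logb 2 (q j)) : ℝ) : ℂ) := by
    rw [hV.matLog2_eq, ← trace_conj_diagonal_mul, ← hU.eq]
  rw [relTrace, Matrix.mul_sub, trace_sub, h1, h2, ← Complex.ofReal_sub, Complex.ofReal_re]
  simp only [mul_sub, Finset.sum_sub_distrib, ← Finset.sum_mul]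
  congr 1
  refine Finset.sum_congr rfl fun i _ => ?_
  rw [sum_normSq_row (hU.overlap_unitary hV), one_mul]

lemma sum_overlap_mul_eq_trace {ρ σ U V : Matrix ι ι ℂ} {p q : ι → ℝ} (hU : IsSpectral ρ U p)
    (hV : IsSpectral σ V q) :
    ∑ i, ∑ j, Complex.normSq ((Uᴴ * V) i j) * p i = ρ.trace.re := by
  simp only [hU.trace_eq, ← Finset.sum_mul, sum_normSq_row (hU.overlap_unitary hV), one_mul,
    Complex.ofReal_re]

lemma suppLE_iff_spectral {ρ σ U V : Matrix ι ι ℂ} {p q : ι → ℝ} (hU : IsSpectral ρ U p)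
    (hV : IsSpectral σ V q) :
    suppLE ρ σ ↔ ∀ i j, (Uᴴ * V) i j ≠ 0 → p i ≠ 0 → q j ≠ 0 := by
  have key : Uᴴ * ρ * V = diagonal (fun i => (p i : ℂ)) * (Uᴴ * V) := by
    rw [hU.eq]
    calc _ = (Uᴴ * U) * diagonal (fun i => (p i : ℂ)) * Uᴴ * V := by simp only [Matrix.mul_assoc]
      _ = _ := by rw [hU.star_mul, Matrix.one_mul, Matrix.mul_assoc]
  constructor
  · intro h i j hc hp hq
    have h1 : σ *ᵥ (V *ᵥ Pi.single j 1) = 0 := by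
      have : σ * V = V * diagonal (fun i => (q i : ℂ)) := by
        rw [hV.eq, Matrix.mul_assoc, hV.star_mul, Matrix.mul_one]
      rw [mulVec_mulVec, this, ← mulVec_mulVec]
      have : diagonal (fun i => (q i : ℂ)) *ᵥ Pi.single j 1 = 0 := by
        ext k
        rw [mulVec_diagonal]
        by_cases hk : k = j
        · subst hk; simp [hq]
        · simp [hk]
      rw [this, mulVec_zero]
    have h2 := h _ h1
    have h3 : (Uᴴ * ρ * V) *ᵥ Pi.single j 1 = 0 := by
      rw [← mulVec_mulVec, ← mulVec_mulVec, h2, mulVec_zero]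
    have h4 := congrFun h3 i
    rw [key, mulVec_single_one, col_apply, diagonal_mul] at h4
    simp [hp, hc] at h4
  · intro h v hv
    set y := Vᴴ *ᵥ v with hy
    have hvy : v = V *ᵥ y := by rw [hy, mulVec_mulVec, hV.mul_star, one_mulVec]
    have h1 : ∀ j, q j * y j = 0 := by
      intro j
      have : diagonal (fun i => (q i : ℂ)) *ᵥ y = 0 := by
        have : diagonal (fun i => (q i : ℂ)) *ᵥ y = Vᴴ *ᵥ (σ *ᵥ v) := by
          rw [hV.eq, hy, mulVec_mulVec, mulVec_mulVec]
          congr 1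
          simp only [← Matrix.mul_assoc]
          rw [hV.star_mul, Matrix.one_mul]
        rw [this, hv, mulVec_zero]
      have := congrFun this j
      rwa [mulVec_diagonal] at this
    have h2 : (Uᴴ * ρ * V) *ᵥ y = 0 := by
      rw [key]
      ext i
      simp only [mulVec, dotProduct, diagonal_mul, Pi.zero_apply]
      refine Finset.sum_eq_zero fun j _ => ?_
      by_cases hc : (Uᴴ * V) i j = 0
      · simp [hc]
      by_cases hp : p i = 0
      · simp [hp]
      have hq := h i j hc hp
      have : y j = 0 := by simpa [hq] using h1 j
      simp [this]
    calc ρ *ᵥ v = (U * Uᴴ) *ᵥ (ρ *ᵥ (V *ᵥ y)) := by rw [hU.mul_star, one_mulVec, ← hvy]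
      _ = U *ᵥ ((Uᴴ * ρ * V) *ᵥ y) := by simp only [mulVec_mulVec, Matrix.mul_assoc]
      _ = 0 := by rw [h2, mulVec_zero]

end Spectral

section Scalar

variable {K L : Type*} [Fintype K] [Fintype L]

lemma tendsto_log_sub_log_atTop {p q : ℝ} (hp : 0 < p) (hq : 0 < q) :
    Filter.Tendsto (fun T => Real.log (q + T * p) - Real.log q - Real.log T) Filter.atTop
      (nhds (Real.log p - Real.log q)) := by
  have h1 : Filter.Tendsto (fun T : ℝ => q * T⁻¹ + p) Filter.atTop (nhds (q * 0 + p)) :=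
    (tendsto_inv_atTop_zero.const_mul q).add_const p
  rw [mul_zero, zero_add] at h1
  have h2 := ((Real.continuousAt_log hp.ne').tendsto.comp h1).sub_const (Real.log q)
  refine h2.congr' ?_
  filter_upwards [Filter.eventually_gt_atTop 0] with T hT
  have : q + T * p = (q * T⁻¹ + p) * T := by field_simp
  have h3 : 0 < q * T⁻¹ + p := by positivity
  rw [Function.comp_apply, this, Real.log_mul h3.ne' hT.ne']
  ring

/-- Comparison of classical relative entropies through the integral representation
`-log x = ∫₀^∞ (1 / (x + t) - 1 / (1 + t)) dt`. -/
lemma sum_mul_log_sub_log_le {w p q : K → ℝ} {w' p' q' : L → ℝ}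
    (hw : ∀ k, 0 ≤ w k) (hp : ∀ k, 0 ≤ p k) (hq : ∀ k, 0 ≤ q k)
    (hs : ∀ k, w k ≠ 0 → p k ≠ 0 → q k ≠ 0)
    (hw' : ∀ k, 0 ≤ w' k) (hp' : ∀ k, 0 ≤ p' k) (hq' : ∀ k, 0 ≤ q' k)
    (hs' : ∀ k, w' k ≠ 0 → p' k ≠ 0 → q' k ≠ 0)
    (hm : ∑ k, w k * p k = ∑ k, w' k * p' k)
    (hle : ∀ t : ℝ, 0 < t →
      ∑ k, w k * (p k ^ 2 / (q k + t * p k)) ≤ ∑ k, w' k * (p' k ^ 2 / (q' k + t * p' k))) :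
    ∑ k, w k * (p k * (Real.log (p k) - Real.log (q k))) ≤
      ∑ k, w' k * (p' k * (Real.log (p' k) - Real.log (q' k))) := by
  have deriv_aux : ∀ {w p q : ℝ}, 0 ≤ w → 0 ≤ p → 0 ≤ q → (w ≠ 0 → p ≠ 0 → q ≠ 0) →
      ∀ t : ℝ, 0 ≤ t → HasDerivAt (fun T => w * (p * (Real.log (q + T * p) - Real.log q)))
        (w * (p ^ 2 / (q + t * p))) t := by
    intro w p q hw hp hq hs t ht
    by_cases h0 : w = 0
    · simpa [h0] using hasDerivAt_const t (0 : ℝ)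
    by_cases h1 : p = 0
    · simpa [h1] using hasDerivAt_const t (0 : ℝ)
    have hq0 : 0 < q := lt_of_le_of_ne hq (hs h0 h1).symm
    have hpos : 0 < q + t * p := by positivity
    have hd : HasDerivAt (fun T : ℝ => q + T * p) p t := by
      simpa using ((hasDerivAt_id t).mul_const p).const_add q
    have := (((hd.log hpos.ne').sub_const (Real.log q)).const_mul p).const_mul w
    have e : w * (p ^ 2 / (q + t * p)) = w * (p * (p / (q + t * p))) := by ring
    rw [e]
    exact this
  have lim_aux : ∀ {w p q : ℝ}, 0 ≤ w → 0 ≤ p → 0 ≤ q → (w ≠ 0 → p ≠ 0 → q ≠ 0) →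
      Filter.Tendsto (fun T => w * (p * (Real.log (q + T * p) - Real.log q)) -
        w * p * Real.log T) Filter.atTop (nhds (w * (p * (Real.log p - Real.log q)))) := by
    intro w p q hw hp hq hs
    by_cases h0 : w = 0
    · simp [h0]
    by_cases h1 : p = 0
    · simp [h1]
    have hq0 : 0 < q := lt_of_le_of_ne hq (hs h0 h1).symm
    have hp0 : 0 < p := lt_of_le_of_ne hp (Ne.symm h1)
    refine (((tendsto_log_sub_log_atTop hp0 hq0).const_mul p).const_mul w).congr fun T => ?_
    ring
  set F : ℝ → ℝ := fun T => ∑ k, w k * (p k * (Real.log (q k + T * p k) - Real.log (q k))) with hF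
  set G : ℝ → ℝ := fun T => ∑ k, w' k * (p' k * (Real.log (q' k + T * p' k) - Real.log (q' k)))
    with hG
  have hFd : ∀ t, 0 ≤ t → HasDerivAt F (∑ k, w k * (p k ^ 2 / (q k + t * p k))) t := fun t ht =>
    HasDerivAt.fun_sum fun k _ => deriv_aux (hw k) (hp k) (hq k) (hs k) t ht
  have hGd : ∀ t, 0 ≤ t → HasDerivAt G (∑ k, w' k * (p' k ^ 2 / (q' k + t * p' k))) t := fun t ht =>
    HasDerivAt.fun_sum fun k _ => deriv_aux (hw' k) (hp' k) (hq' k) (hs' k) t ht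
  have hmono : MonotoneOn (fun t => G t - F t) (Set.Ici 0) := by
    refine monotoneOn_of_hasDerivWithinAt_nonneg (convex_Ici 0)
      (f' := fun t => (∑ k, w' k * (p' k ^ 2 / (q' k + t * p' k))) -
        ∑ k, w k * (p k ^ 2 / (q k + t * p k))) ?_ ?_ ?_
    · exact fun t ht => ((hGd t ht).sub (hFd t ht)).continuousAt.continuousWithinAt
    · intro t ht
      rw [interior_Ici] at ht
      exact ((hGd t ht.le).sub (hFd t ht.le)).hasDerivWithinAt
    · intro t ht
      rw [interior_Ici] at ht
      exact sub_nonneg.mpr (hle t ht)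
  have hFG : ∀ T, 0 ≤ T → F T ≤ G T := by
    intro T hT
    have h := hmono (Set.mem_Ici.mpr le_rfl) (Set.mem_Ici.mpr hT) hT
    have hF0 : F 0 = 0 := by simp [hF]
    have hG0 : G 0 = 0 := by simp [hG]
    simp only [hF0, hG0] at h
    linarith
  have hFl := tendsto_finsetSum Finset.univ
    fun k _ => lim_aux (hw k) (hp k) (hq k) (hs k)
  have hGl := tendsto_finsetSum Finset.univ
    fun k _ => lim_aux (hw' k) (hp' k) (hq' k) (hs' k)
  refine le_of_tendsto_of_tendsto hFl hGl ?_
  filter_upwards [Filter.eventually_ge_atTop 0] with T hT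
  simp only [Finset.sum_sub_distrib, ← Finset.sum_mul, hm]
  have := hFG T hT
  simp only [hF, hG] at this
  linarith

end Scalar

section Variational

open Matrix

variable {ι κ : Type} [Fintype ι] [DecidableEq ι] [Fintype κ] [DecidableEq κ]

/-- The functional `2 Re⟨W, ρ⟩ − ⟨W, (L_σ + t R_ρ) W⟩`, which is linear in `(ρ, σ)`. Its supremum over
`W` is the integrand of the integral representation of the relative entropy. -/
def relVar (t : ℝ) (W ρ σ : Matrix ι ι ℂ) : ℝ :=
  2 * (Wᴴ * ρ).trace.re - (Wᴴ * σ * W).trace.re - t * (Wᴴ * W * ρ).trace.re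

lemma relVar_eq_sum (t : ℝ) {ρ σ U V : Matrix ι ι ℂ} {p q : ι → ℝ} (hU : IsSpectral ρ U p)
    (hV : IsSpectral σ V q) (Y : Matrix ι ι ℂ) :
    relVar t (V * Y * Uᴴ) ρ σ = ∑ i, ∑ j, (2 * p i * ((Uᴴ * V) i j * Y j i).re -
      (q j + t * p i) * Complex.normSq (Y j i)) := by
  have cyc : ∀ A : Matrix ι ι ℂ, (U * A * Uᴴ).trace = A.trace := fun A => by
    rw [Matrix.trace_mul_comm, ← Matrix.mul_assoc, hU.star_mul, Matrix.one_mul]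
  have hW : (V * Y * Uᴴ)ᴴ = U * Yᴴ * Vᴴ := by
    simp only [conjTranspose_mul, conjTranspose_conjTranspose, Matrix.mul_assoc]
  have h1 : ((V * Y * Uᴴ)ᴴ * ρ).trace =
      ∑ i, ∑ j, star (Y j i) * star ((Uᴴ * V) i j) * (p i : ℂ) := by
    have : (V * Y * Uᴴ)ᴴ * ρ = U * (Yᴴ * (Uᴴ * V)ᴴ * diagonal (fun i => (p i : ℂ))) * Uᴴ := by
      rw [hW]
      nth_rw 1 [hU.eq]
      simp only [conjTranspose_mul, conjTranspose_conjTranspose, Matrix.mul_assoc]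
    rw [this, cyc]
    simp only [Matrix.trace, diag_apply, mul_diagonal, Matrix.mul_apply (M := Yᴴ),
      conjTranspose_apply, Finset.sum_mul]
  have h2 : ((V * Y * Uᴴ)ᴴ * σ * (V * Y * Uᴴ)).trace =
      ∑ i, ∑ j, (q j : ℂ) * (Complex.normSq (Y j i) : ℂ) := by
    have : (V * Y * Uᴴ)ᴴ * σ * (V * Y * Uᴴ) = U * (Yᴴ * (diagonal (fun i => (q i : ℂ)) * Y)) * Uᴴ := by
      rw [hW]
      nth_rw 1 [hV.eq]
      calc _ = U * Yᴴ * (Vᴴ * V) * diagonal (fun i => (q i : ℂ)) * (Vᴴ * V) * Y * Uᴴ := by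
            simp only [Matrix.mul_assoc]
        _ = _ := by
            rw [hV.star_mul]
            simp only [Matrix.mul_assoc, Matrix.one_mul]
    rw [this, cyc]
    simp only [Matrix.trace, diag_apply, Matrix.mul_apply (M := Yᴴ), diagonal_mul,
      conjTranspose_apply]
    refine Finset.sum_congr rfl fun i _ => Finset.sum_congr rfl fun j _ => ?_
    rw [Complex.normSq_eq_conj_mul_self, starRingEnd_apply]
    ring
  have h3 : ((V * Y * Uᴴ)ᴴ * (V * Y * Uᴴ) * ρ).trace =
      ∑ i, ∑ j, (p i : ℂ) * (Complex.normSq (Y j i) : ℂ) := by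
    have : (V * Y * Uᴴ)ᴴ * (V * Y * Uᴴ) * ρ = U * (Yᴴ * Y * diagonal (fun i => (p i : ℂ))) * Uᴴ := by
      rw [hW]
      nth_rw 1 [hU.eq]
      calc _ = U * Yᴴ * (Vᴴ * V) * Y * (Uᴴ * U) * diagonal (fun i => (p i : ℂ)) * Uᴴ := by
            simp only [Matrix.mul_assoc]
        _ = _ := by
            rw [hV.star_mul, hU.star_mul]
            simp only [Matrix.mul_assoc, Matrix.one_mul]
    rw [this, cyc]
    simp only [Matrix.trace, diag_apply, mul_diagonal, Matrix.mul_apply (M := Yᴴ),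
      conjTranspose_apply, Finset.sum_mul]
    refine Finset.sum_congr rfl fun i _ => Finset.sum_congr rfl fun j _ => ?_
    rw [Complex.normSq_eq_conj_mul_self, starRingEnd_apply]
    ring
  rw [relVar, h1, h2, h3]
  simp only [Complex.re_sum, Finset.mul_sum, ← Finset.sum_sub_distrib]
  refine Finset.sum_congr rfl fun i _ => Finset.sum_congr rfl fun j _ => ?_
  simp only [Complex.star_def, Complex.mul_re, Complex.mul_im, Complex.conj_re, Complex.conj_im,
    Complex.ofReal_re, Complex.ofReal_im]
  ring

lemma relVar_le_sum {t : ℝ} (ht : 0 < t) {ρ σ U V : Matrix ι ι ℂ} {p q : ι → ℝ}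
    (hU : IsSpectral ρ U p) (hV : IsSpectral σ V q) (hp : ∀ i, 0 ≤ p i) (hq : ∀ i, 0 ≤ q i)
    (W : Matrix ι ι ℂ) :
    relVar t W ρ σ ≤ ∑ i, ∑ j, Complex.normSq ((Uᴴ * V) i j) * (p i ^ 2 / (q j + t * p i)) := by
  have hW : W = V * (Vᴴ * W * U) * Uᴴ := by
    calc W = (V * Vᴴ) * W * (U * Uᴴ) := by
          rw [hV.mul_star, hU.mul_star, Matrix.one_mul, Matrix.mul_one]
      _ = _ := by simp only [Matrix.mul_assoc]
  rw [hW, relVar_eq_sum t hU hV]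
  refine Finset.sum_le_sum fun i _ => Finset.sum_le_sum fun j _ => ?_
  set c := (Uᴴ * V) i j
  set y := (Vᴴ * W * U) j i
  have hpi := hp i
  have hqj := hq j
  have hre : (c * y).re ≤ ‖c‖ * ‖y‖ := (Complex.re_le_norm _).trans (norm_mul c y).le
  rw [Complex.normSq_eq_norm_sq, Complex.normSq_eq_norm_sq]
  rcases eq_or_lt_of_le hpi with h0 | h0
  · rw [← h0]
    have : 0 ≤ q j * ‖y‖ ^ 2 := by positivity
    simpa using this
  · have hd : 0 < q j + t * p i := by positivity
    have h1 : 2 * p i * (c * y).re ≤ 2 * p i * (‖c‖ * ‖y‖) := by gcongr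
    refine (sub_le_sub_right h1 _).trans ?_
    rw [← mul_div_assoc, le_div_iff₀ hd]
    nlinarith [sq_nonneg ((q j + t * p i) * ‖y‖ - p i * ‖c‖)]

lemma exists_relVar_eq_sum {t : ℝ} (ht : 0 < t) {ρ σ U V : Matrix ι ι ℂ} {p q : ι → ℝ}
    (hU : IsSpectral ρ U p) (hV : IsSpectral σ V q) (hp : ∀ i, 0 ≤ p i) (hq : ∀ i, 0 ≤ q i) :
    ∃ W, relVar t W ρ σ =
      ∑ i, ∑ j, Complex.normSq ((Uᴴ * V) i j) * (p i ^ 2 / (q j + t * p i)) := by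
  refine ⟨V * (Matrix.of fun j i => star ((Uᴴ * V) i j) * ((p i / (q j + t * p i) : ℝ) : ℂ)) * Uᴴ, ?_⟩
  rw [relVar_eq_sum t hU hV]
  refine Finset.sum_congr rfl fun i _ => Finset.sum_congr rfl fun j _ => ?_
  rw [of_apply]
  set c := (Uᴴ * V) i j
  have hpi := hp i
  have hqj := hq j
  have h1 : c * (star c * ((p i / (q j + t * p i) : ℝ) : ℂ)) =
      ((Complex.normSq c * (p i / (q j + t * p i)) : ℝ) : ℂ) := by
    rw [← mul_assoc, Complex.star_def, Complex.mul_conj]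
    push_cast
    rfl
  have h2 : Complex.normSq (star c * ((p i / (q j + t * p i) : ℝ) : ℂ)) =
      Complex.normSq c * (p i / (q j + t * p i)) ^ 2 := by
    rw [Complex.normSq_mul, Complex.normSq_ofReal, Complex.star_def, Complex.normSq_conj, sq]
  rw [h1, h2, Complex.ofReal_re]
  rcases eq_or_lt_of_le hpi with h0 | h0
  · simp [← h0]
  · have hd : 0 < q j + t * p i := by positivity
    field_simp
    ring

/-- A variational criterion for comparing sums of relative entropies. -/
lemma sum_relTrace_le_of_relVar {X Y : Type} [Fintype X] [Fintype Y]
    {ρ σ : X → Matrix ι ι ℂ} {ρ' σ' : Y → Matrix κ κ ℂ}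
    (hρ : ∀ x, (ρ x).PosSemidef) (hσ : ∀ x, (σ x).PosSemidef) (hs : ∀ x, suppLE (ρ x) (σ x))
    (hρ' : ∀ y, (ρ' y).PosSemidef) (hσ' : ∀ y, (σ' y).PosSemidef)
    (hs' : ∀ y, suppLE (ρ' y) (σ' y))
    (htr : ∑ x, (ρ x).trace.re = ∑ y, (ρ' y).trace.re)
    (hvar : ∀ t : ℝ, ∀ W : X → Matrix ι ι ℂ, ∃ W' : Y → Matrix κ κ ℂ,
      ∑ x, relVar t (W x) (ρ x) (σ x) ≤ ∑ y, relVar t (W' y) (ρ' y) (σ' y)) :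
    ∑ x, relTrace (ρ x) (σ x) ≤ ∑ y, relTrace (ρ' y) (σ' y) := by
  choose U p hU hp using fun x => (hρ x).exists_isSpectral
  choose V q hV hq using fun x => (hσ x).exists_isSpectral
  choose U' p' hU' hp' using fun x => (hρ' x).exists_isSpectral
  choose V' q' hV' hq' using fun x => (hσ' x).exists_isSpectral
  have key := sum_mul_log_sub_log_le (K := X × ι × ι) (L := Y × κ × κ)
    (w := fun k => Complex.normSq (((U k.1)ᴴ * V k.1) k.2.1 k.2.2))
    (p := fun k => p k.1 k.2.1) (q := fun k => q k.1 k.2.2)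
    (w' := fun k => Complex.normSq (((U' k.1)ᴴ * V' k.1) k.2.1 k.2.2))
    (p' := fun k => p' k.1 k.2.1) (q' := fun k => q' k.1 k.2.2)
    (fun _ => Complex.normSq_nonneg _) (fun _ => hp _ _) (fun _ => hq _ _)
    (fun k hw => (suppLE_iff_spectral (hU k.1) (hV k.1)).1 (hs k.1) _ _
      (fun h => hw (by simp only [h, map_zero])))
    (fun _ => Complex.normSq_nonneg _) (fun _ => hp' _ _) (fun _ => hq' _ _)
    (fun k hw => (suppLE_iff_spectral (hU' k.1) (hV' k.1)).1 (hs' k.1) _ _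
      (fun h => hw (by simp only [h, map_zero])))
    (by simpa only [Fintype.sum_prod_type, sum_overlap_mul_eq_trace (hU _) (hV _),
          sum_overlap_mul_eq_trace (hU' _) (hV' _)] using htr)
    (by
      intro t ht
      simp only [Fintype.sum_prod_type]
      choose W hW using fun x => exists_relVar_eq_sum ht (hU x) (hV x) (hp x) (hq x)
      obtain ⟨W', hW'⟩ := hvar t W
      simp only [hW] at hW'
      exact hW'.trans (Finset.sum_le_sum fun y _ =>
        relVar_le_sum ht (hU' y) (hV' y) (hp' y) (hq' y) (W' y)))
  have hlog : 0 ≤ (Real.log 2)⁻¹ := inv_nonneg.mpr (Real.log_nonneg one_le_two)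
  have key2 := mul_le_mul_of_nonneg_left key hlog
  have e : ∀ w p q : ℝ, w * (p * (Real.logb 2 p - Real.logb 2 q)) =
      (Real.log 2)⁻¹ * (w * (p * (Real.log p - Real.log q))) := by
    intro w p q
    rw [Real.logb, Real.logb]
    ring
  simpa only [relTrace_eq_sum (hU _) (hV _), relTrace_eq_sum (hU' _) (hV' _), e, ← Finset.mul_sum,
    Fintype.sum_prod_type] using key2

omit [DecidableEq ι] in
lemma relVar_sum {X : Type} [Fintype X] (t : ℝ) (W : Matrix ι ι ℂ) (ρ σ : X → Matrix ι ι ℂ) :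
    relVar t W (∑ x, ρ x) (∑ x, σ x) = ∑ x, relVar t W (ρ x) (σ x) := by
  simp only [relVar, Finset.mul_sum, Finset.sum_mul, Matrix.trace_sum, Complex.re_sum,
    Finset.sum_sub_distrib]

omit [DecidableEq ι] in
lemma Matrix.PosSemidef.suppLE_sum {X : Type} [Fintype X] {ρ σ : X → Matrix ι ι ℂ}
    (hσ : ∀ x, (σ x).PosSemidef) (hs : ∀ x, suppLE (ρ x) (σ x)) :
    suppLE (∑ x, ρ x) (∑ x, σ x) := by
  intro v hv
  have h1 : ∑ x, star v ⬝ᵥ (σ x *ᵥ v) = 0 := by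
    rw [← dotProduct_sum, ← sum_mulVec, hv, dotProduct_zero]
  rw [Finset.sum_eq_zero_iff_of_nonneg fun x _ => (hσ x).dotProduct_mulVec_nonneg v] at h1
  rw [sum_mulVec]
  exact Finset.sum_eq_zero fun x hx =>
    hs x v (((hσ x).dotProduct_mulVec_zero_iff v).1 (h1 x hx))

/-- Joint convexity (sub-additivity) of the quantum relative entropy. -/
lemma relTrace_sum_le {X : Type} [Fintype X] {ρ σ : X → Matrix ι ι ℂ}
    (hρ : ∀ x, (ρ x).PosSemidef) (hσ : ∀ x, (σ x).PosSemidef) (hs : ∀ x, suppLE (ρ x) (σ x)) :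
    relTrace (∑ x, ρ x) (∑ x, σ x) ≤ ∑ x, relTrace (ρ x) (σ x) := by
  have := sum_relTrace_le_of_relVar (X := Unit) (ρ := fun _ => ∑ x, ρ x) (σ := fun _ => ∑ x, σ x)
    (fun _ => posSemidef_sum _ fun x _ => hρ x) (fun _ => posSemidef_sum _ fun x _ => hσ x)
    (fun _ => Matrix.PosSemidef.suppLE_sum hσ hs) hρ hσ hs
    (by simp [Matrix.trace_sum]) (fun t W => ⟨fun _ => W (), by simp [relVar_sum]⟩)
  simpa using this

omit [DecidableEq ι] [DecidableEq κ] in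
lemma suppLE_conj {ρ σ : Matrix κ κ ℂ} (hσ : σ.PosSemidef) (hs : suppLE ρ σ) (E : Matrix κ ι ℂ) :
    suppLE (Eᴴ * ρ * E) (Eᴴ * σ * E) := by
  intro v hv
  have h1 : star (E *ᵥ v) ⬝ᵥ (σ *ᵥ (E *ᵥ v)) = 0 := by
    rw [star_mulVec, ← dotProduct_mulVec, mulVec_mulVec, mulVec_mulVec, hv, dotProduct_zero]
  have h2 := hs _ ((hσ.dotProduct_mulVec_zero_iff _).1 h1)
  rw [← mulVec_mulVec, ← mulVec_mulVec, h2, mulVec_zero]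

/-- The quantum relative entropy does not increase under pinching. -/
lemma sum_relTrace_conj_le {X : Type} [Fintype X] [DecidableEq X] {ρ σ : Matrix κ κ ℂ}
    (hρ : ρ.PosSemidef) (hσ : σ.PosSemidef) (hs : suppLE ρ σ) (E : X → Matrix κ ι ℂ)
    (hE : ∀ x y, (E x)ᴴ * E y = if x = y then 1 else 0) (hE' : ∑ x, E x * (E x)ᴴ = 1) :
    ∑ x, relTrace ((E x)ᴴ * ρ * E x) ((E x)ᴴ * σ * E x) ≤ relTrace ρ σ := by
  have htr : ∑ x, ((E x)ᴴ * ρ * E x).trace = ρ.trace := by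
    simp only [Matrix.mul_assoc, Matrix.trace_mul_comm (E _)ᴴ]
    rw [← Matrix.trace_sum, ← Finset.mul_sum, hE', Matrix.mul_one]
  have := sum_relTrace_le_of_relVar (Y := Unit) (ρ' := fun _ => ρ) (σ' := fun _ => σ)
    (fun x => hρ.conjTranspose_mul_mul_same (E x)) (fun x => hσ.conjTranspose_mul_mul_same (E x))
    (fun x => suppLE_conj hσ hs (E x)) (fun _ => hρ) (fun _ => hσ) (fun _ => hs)
    (by rw [← Complex.re_sum, htr]; simp) (fun t W => ⟨fun _ => ∑ x, E x * W x * (E x)ᴴ, ?_⟩)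
  · simpa using this
  · have cyc : ∀ (F : Matrix κ ι ℂ) (A : Matrix ι κ ℂ), (F * A).trace = (A * F).trace :=
      Matrix.trace_mul_comm
    have hW : (∑ x, E x * W x * (E x)ᴴ)ᴴ = ∑ x, E x * (W x)ᴴ * (E x)ᴴ := by
      simp only [conjTranspose_sum, conjTranspose_mul, conjTranspose_conjTranspose,
        Matrix.mul_assoc]
    have h1 : ((∑ x, E x * W x * (E x)ᴴ)ᴴ * ρ).trace =
        ∑ x, ((W x)ᴴ * ((E x)ᴴ * ρ * E x)).trace := by
      rw [hW, Finset.sum_mul, Matrix.trace_sum]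
      refine Finset.sum_congr rfl fun x _ => ?_
      simp only [Matrix.mul_assoc]
      rw [cyc]
      simp only [Matrix.mul_assoc]
    have h2 : ((∑ x, E x * W x * (E x)ᴴ)ᴴ * σ * (∑ x, E x * W x * (E x)ᴴ)).trace =
        ∑ x, ((W x)ᴴ * ((E x)ᴴ * σ * E x) * W x).trace := by
      rw [hW, Finset.sum_mul, Finset.sum_mul, Matrix.trace_sum]
      refine Finset.sum_congr rfl fun x _ => ?_
      rw [Finset.mul_sum, Matrix.trace_sum, Finset.sum_eq_single x]
      · simp only [Matrix.mul_assoc]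
        rw [cyc]
        simp only [Matrix.mul_assoc]
        rw [hE, if_pos rfl, Matrix.mul_one]
      · intro y _ hyx
        simp only [Matrix.mul_assoc]
        rw [cyc]
        simp only [Matrix.mul_assoc]
        rw [hE, if_neg hyx]
        simp
      · simp
    have h3 : ((∑ x, E x * W x * (E x)ᴴ)ᴴ * (∑ x, E x * W x * (E x)ᴴ) * ρ).trace =
        ∑ x, ((W x)ᴴ * W x * ((E x)ᴴ * ρ * E x)).trace := by
      rw [hW, Finset.sum_mul, Finset.sum_mul, Matrix.trace_sum]
      refine Finset.sum_congr rfl fun x _ => ?_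
      rw [Finset.mul_sum, Finset.sum_eq_single x]
      · calc _ = (E x * ((W x)ᴴ * ((E x)ᴴ * E x) * W x * (E x)ᴴ * ρ)).trace := by
              simp only [Matrix.mul_assoc]
          _ = _ := by
              rw [hE, if_pos rfl, Matrix.mul_one, cyc]
              simp only [Matrix.mul_assoc]
      · intro y _ hyx
        calc E x * (W x)ᴴ * (E x)ᴴ * (E y * W y * (E y)ᴴ)
            = E x * (W x)ᴴ * ((E x)ᴴ * E y) * (W y * (E y)ᴴ) := by
              simp only [Matrix.mul_assoc]
          _ = 0 := by
              rw [hE, if_neg (Ne.symm hyx)]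
              simp
      · simp
    simp only [Finset.univ_unique, Finset.sum_singleton, relVar]
    rw [h1, h2, h3]
    simp only [Complex.re_sum, Finset.mul_sum, Finset.sum_sub_distrib, le_refl]

end Variational

section Tensor

open Matrix Kronecker

variable {ι κ : Type} [Fintype ι] [DecidableEq ι] [Fintype κ] [DecidableEq κ]

lemma IsSpectral.kronecker {A U : Matrix ι ι ℂ} {B V : Matrix κ κ ℂ} {p : ι → ℝ} {q : κ → ℝ}
    (hU : IsSpectral A U p) (hV : IsSpectral B V q) :
    IsSpectral (A ⊗ₖ B) (U ⊗ₖ V) (fun k => p k.1 * q k.2) where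
  star_mul := by
    rw [conjTranspose_kronecker, ← mul_kronecker_mul, hU.star_mul, hV.star_mul]
    convert one_kronecker_one (m := ι) (n := κ) (α := ℂ)
  mul_star := by
    rw [conjTranspose_kronecker, ← mul_kronecker_mul, hU.mul_star, hV.mul_star]
    convert one_kronecker_one (m := ι) (n := κ) (α := ℂ)
  eq := by
    rw [hU.eq, hV.eq, mul_kronecker_mul, mul_kronecker_mul, diagonal_kronecker_diagonal,
      ← conjTranspose_kronecker]
    congr!
    push_cast
    rfl

lemma suppLE_kronecker {ρ σ : Matrix ι ι ℂ} {ν μ : Matrix κ κ ℂ} (hρ : ρ.PosSemidef)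
    (hσ : σ.PosSemidef) (hν : ν.PosSemidef) (hμ : μ.PosSemidef) (h : suppLE ρ σ)
    (h' : suppLE ν μ) : suppLE (ρ ⊗ₖ ν) (σ ⊗ₖ μ) := by
  obtain ⟨U, p, hU, -⟩ := hρ.exists_isSpectral
  obtain ⟨V, q, hV, -⟩ := hσ.exists_isSpectral
  obtain ⟨U', p', hU', -⟩ := hν.exists_isSpectral
  obtain ⟨V', q', hV', -⟩ := hμ.exists_isSpectral
  rw [suppLE_iff_spectral (hU.kronecker hU') (hV.kronecker hV')]
  rw [suppLE_iff_spectral hU hV] at h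
  rw [suppLE_iff_spectral hU' hV'] at h'
  intro i j
  rw [conjTranspose_kronecker, ← mul_kronecker_mul, kroneckerMap_apply]
  intro hc hp
  exact mul_ne_zero (h _ _ (left_ne_zero_of_mul hc) (left_ne_zero_of_mul hp))
    (h' _ _ (right_ne_zero_of_mul hc) (right_ne_zero_of_mul hp))

/-- Additivity of the relative entropy on tensor products of unnormalized states. -/
lemma relTrace_kronecker {ρ σ : Matrix ι ι ℂ} {ν μ : Matrix κ κ ℂ} (hρ : ρ.PosSemidef)
    (hσ : σ.PosSemidef) (hν : ν.PosSemidef) (hμ : μ.PosSemidef) (h : suppLE ρ σ)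
    (h' : suppLE ν μ) :
    relTrace (ρ ⊗ₖ ν) (σ ⊗ₖ μ) =
      ν.trace.re * relTrace ρ σ + ρ.trace.re * relTrace ν μ := by
  obtain ⟨U, p, hU, -⟩ := hρ.exists_isSpectral
  obtain ⟨V, q, hV, -⟩ := hσ.exists_isSpectral
  obtain ⟨U', p', hU', -⟩ := hν.exists_isSpectral
  obtain ⟨V', q', hV', -⟩ := hμ.exists_isSpectral
  rw [suppLE_iff_spectral hU hV] at h
  rw [suppLE_iff_spectral hU' hV'] at h'
  rw [relTrace_eq_sum (hU.kronecker hU') (hV.kronecker hV'), relTrace_eq_sum hU hV,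
    relTrace_eq_sum hU' hV', ← sum_overlap_mul_eq_trace hU hV, ← sum_overlap_mul_eq_trace hU' hV']
  have e : ∀ (i : ι) (k : κ) (j : ι) (l : κ),
      Complex.normSq (((U ⊗ₖ U')ᴴ * (V ⊗ₖ V')) (i, k) (j, l)) *
        (p i * p' k * (Real.logb 2 (p i * p' k) - Real.logb 2 (q j * q' l))) =
      (Complex.normSq ((U'ᴴ * V') k l) * p' k) * (Complex.normSq ((Uᴴ * V) i j) *
        (p i * (Real.logb 2 (p i) - Real.logb 2 (q j)))) +
      (Complex.normSq ((Uᴴ * V) i j) * p i) * (Complex.normSq ((U'ᴴ * V') k l) *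
        (p' k * (Real.logb 2 (p' k) - Real.logb 2 (q' l)))) := by
    intro i k j l
    rw [conjTranspose_kronecker, ← mul_kronecker_mul, kroneckerMap_apply, Complex.normSq_mul]
    by_cases hc : (Uᴴ * V) i j = 0
    · simp [hc]
    by_cases hc' : (U'ᴴ * V') k l = 0
    · simp [hc']
    by_cases hp : p i = 0
    · simp [hp]
    by_cases hp' : p' k = 0
    · simp [hp']
    rw [Real.logb_mul hp hp', Real.logb_mul (h _ _ hc hp) (h' _ _ hc' hp')]
    ring
  simp only [Fintype.sum_prod_type, e, Finset.sum_add_distrib]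
  congr 1
  · simp only [← Finset.mul_sum, ← Finset.sum_mul]
  · simp only [← Finset.mul_sum, ← Finset.sum_mul]

end Tensor

section ClassicalQuantum

open Matrix Kronecker

variable {R X B : Type} [Fintype R] [DecidableEq R] [Fintype X] [DecidableEq X]
  [Fintype B] [DecidableEq B]

/-- The isometry `|r⟩ ↦ |r⟩|x⟩`. -/
def blockEmb (R : Type) [DecidableEq R] {X : Type} [DecidableEq X] (x : X) :
    Matrix (R × X) R ℂ :=
  Matrix.of fun k r => if k.1 = r ∧ k.2 = x then 1 else 0

omit [Fintype R] [Fintype X] in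
lemma blockEmb_apply (x : X) (k : R × X) (r : R) :
    blockEmb R x k r = if k.1 = r then if k.2 = x then 1 else 0 else 0 := by
  simp [blockEmb, ite_and]

omit [Fintype R] [Fintype X] in
lemma blockEmb_conjTranspose_apply (x : X) (k : R × X) (r : R) :
    (blockEmb R x)ᴴ r k = if k.1 = r then if k.2 = x then 1 else 0 else 0 := by
  rw [conjTranspose_apply, blockEmb_apply]
  split_ifs <;> simp

lemma blockEmb_conj_apply (ρ : Matrix (R × X) (R × X) ℂ) (x : X) (r s : R) :
    ((blockEmb R x)ᴴ * ρ * blockEmb R x) r s = ρ (r, x) (s, x) := by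
  simp [-conjTranspose_apply, blockEmb_apply, blockEmb_conjTranspose_apply,
    Matrix.mul_apply, Fintype.sum_prod_type]

lemma blockEmb_orthogonal (x y : X) :
    (blockEmb R x)ᴴ * blockEmb R y = if x = y then 1 else 0 := by
  ext r s
  by_cases h : x = y
  · subst h
    simp [-conjTranspose_apply, blockEmb_apply, blockEmb_conjTranspose_apply,
    Matrix.mul_apply, Fintype.sum_prod_type,
      one_apply, eq_comm]
  · simp [-conjTranspose_apply, blockEmb_apply, blockEmb_conjTranspose_apply,
    Matrix.mul_apply, Fintype.sum_prod_type,
      h, Ne.symm h]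

lemma sum_blockEmb_mul_star : ∑ x : X, blockEmb R x * (blockEmb R x)ᴴ = 1 := by
  ext k l
  rw [Matrix.sum_apply]
  simp only [blockEmb_apply, blockEmb_conjTranspose_apply, Matrix.mul_apply, one_apply,
    Prod.ext_iff]
  by_cases h1 : k.1 = l.1 <;> by_cases h2 : k.2 = l.2 <;> simp [h1, h2, eq_comm]

omit [DecidableEq B] in
lemma idTensor_cqChannel (ν : X → Matrix B B ℂ) (ρ : Matrix (R × X) (R × X) ℂ) :
    idTensor (cqChannel ν) ρ = ∑ x, ((blockEmb R x)ᴴ * ρ * blockEmb R x) ⊗ₖ ν x := by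
  ext k l
  simp only [idTensor, cqChannel, Matrix.sum_apply, kroneckerMap_apply, blockEmb_conj_apply,
    Matrix.smul_apply, smul_eq_mul]

lemma sum_trace_blockEmb_conj (ρ : Matrix (R × X) (R × X) ℂ) :
    ∑ x : X, ((blockEmb R x)ᴴ * ρ * blockEmb R x).trace = ρ.trace := by
  simp only [Matrix.trace, diag_apply, blockEmb_conj_apply, Fintype.sum_prod_type]
  exact Finset.sum_comm

end ClassicalQuantum

section Amortization

open Matrix Kronecker

variable {X B : Type} [Fintype X] [DecidableEq X] [Fintype B] [DecidableEq B]

lemma relEnt_of_suppLE {ι : Type} [Fintype ι] [DecidableEq ι] {ρ σ : Matrix ι ι ℂ}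
    (h : suppLE ρ σ) : relEnt ρ σ = (relTrace ρ σ : EReal) := if_pos h

lemma relEnt_of_not_suppLE {ι : Type} [Fintype ι] [DecidableEq ι] {ρ σ : Matrix ι ι ℂ}
    (h : ¬ suppLE ρ σ) : relEnt ρ σ = ⊤ := if_neg h

lemma suppLE_idTensor_cqChannel {R : Type} [Fintype R] [DecidableEq R] {ν μ : X → Matrix B B ℂ}
    (hν : ∀ x, IsDensity (ν x)) (hμ : ∀ x, IsDensity (μ x)) (hs : ∀ x, suppLE (ν x) (μ x))
    {ρ σ : Matrix (R × X) (R × X) ℂ} (hρ : ρ.PosSemidef) (hσ : σ.PosSemidef) (h : suppLE ρ σ) :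
    suppLE (idTensor (cqChannel ν) ρ) (idTensor (cqChannel μ) σ) := by
  rw [idTensor_cqChannel, idTensor_cqChannel]
  exact Matrix.PosSemidef.suppLE_sum
    (fun x => (hσ.conjTranspose_mul_mul_same _).kronecker (hμ x).1)
    (fun x => suppLE_kronecker (hρ.conjTranspose_mul_mul_same _) (hσ.conjTranspose_mul_mul_same _)
      (hν x).1 (hμ x).1 (suppLE_conj hσ h _) (hs x))

/-- The relative entropy grows under a pair of classical-quantum channels by at most the average
of the relative entropies of their outputs. -/
lemma relTrace_idTensor_cqChannel_le {R : Type} [Fintype R] [DecidableEq R]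
    {ν μ : X → Matrix B B ℂ}
    (hν : ∀ x, IsDensity (ν x)) (hμ : ∀ x, IsDensity (μ x)) (hs : ∀ x, suppLE (ν x) (μ x))
    {ρ σ : Matrix (R × X) (R × X) ℂ} (hρ : ρ.PosSemidef) (hσ : σ.PosSemidef) (h : suppLE ρ σ) :
    relTrace (idTensor (cqChannel ν) ρ) (idTensor (cqChannel μ) σ) ≤
      relTrace ρ σ + ∑ x, ((blockEmb R x)ᴴ * ρ * blockEmb R x).trace.re *
        relTrace (ν x) (μ x) := by
  have hρx := fun x : X => hρ.conjTranspose_mul_mul_same (blockEmb R x)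
  have hσx := fun x : X => hσ.conjTranspose_mul_mul_same (blockEmb R x)
  have hsx := fun x : X => suppLE_conj hσ h (blockEmb R x)
  rw [idTensor_cqChannel, idTensor_cqChannel]
  refine (relTrace_sum_le (fun x => (hρx x).kronecker (hν x).1)
    (fun x => (hσx x).kronecker (hμ x).1)
    (fun x => suppLE_kronecker (hρx x) (hσx x) (hν x).1 (hμ x).1 (hsx x) (hs x))).trans ?_
  simp only [fun x => relTrace_kronecker (hρx x) (hσx x) (hν x).1 (hμ x).1 (hsx x) (hs x),
    fun x => (hν x).2, Complex.one_re, one_mul, Finset.sum_add_distrib]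
  gcongr
  exact sum_relTrace_conj_le hρ hσ h _ blockEmb_orthogonal sum_blockEmb_mul_star

lemma amortizedDiv_relEnt_cqChannel_le [Nonempty X] {ν μ : X → Matrix B B ℂ}
    (hν : ∀ x, IsDensity (ν x)) (hμ : ∀ x, IsDensity (μ x)) :
    amortizedDiv relEntFam (cqChannel ν) (cqChannel μ) ≤ ⨆ x, relEnt (ν x) (μ x) := by
  refine iSup_le fun R => iSup_le fun ρ => iSup_le fun σ => iSup_le fun hρ => iSup_le fun hσ => ?_
  change relEnt (idTensor (cqChannel ν) ρ) (idTensor (cqChannel μ) σ) - relEnt ρ σ ≤ _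
  by_cases h : suppLE ρ σ
  swap
  · rw [relEnt_of_not_suppLE h, EReal.sub_top]
    exact bot_le
  by_cases hs : ∀ x, suppLE (ν x) (μ x)
  swap
  · push Not at hs
    obtain ⟨x, hx⟩ := hs
    exact le_top.trans ((relEnt_of_not_suppLE hx).ge.trans
      (le_iSup (fun x => relEnt (ν x) (μ x)) x))
  rw [relEnt_of_suppLE h, relEnt_of_suppLE (suppLE_idTensor_cqChannel hν hμ hs hρ.1 hσ.1 h),
    ← EReal.coe_sub]
  obtain ⟨x₀, hx₀⟩ := Finite.exists_max fun x => relTrace (ν x) (μ x)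
  refine le_trans ?_ (le_iSup (fun x => relEnt (ν x) (μ x)) x₀)
  rw [relEnt_of_suppLE (hs x₀), EReal.coe_le_coe_iff]
  have h1 := relTrace_idTensor_cqChannel_le hν hμ hs hρ.1 hσ.1 h
  have hnn : ∀ x : X, 0 ≤ ((blockEmb (Fin R) x)ᴴ * ρ * blockEmb (Fin R) x).trace.re := fun x =>
    (Complex.nonneg_iff.1 (hρ.1.conjTranspose_mul_mul_same _).trace_nonneg).1
  have hsum : ∑ x : X, ((blockEmb (Fin R) x)ᴴ * ρ * blockEmb (Fin R) x).trace.re = 1 := by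
    rw [← Complex.re_sum, sum_trace_blockEmb_conj, hρ.2, Complex.one_re]
  have h2 : ∑ x : X, ((blockEmb (Fin R) x)ᴴ * ρ * blockEmb (Fin R) x).trace.re *
      relTrace (ν x) (μ x) ≤ relTrace (ν x₀) (μ x₀) := by
    calc _ ≤ ∑ x : X, ((blockEmb (Fin R) x)ᴴ * ρ * blockEmb (Fin R) x).trace.re *
          relTrace (ν x₀) (μ x₀) :=
          Finset.sum_le_sum fun x _ => mul_le_mul_of_nonneg_left (hx₀ x) (hnn x)
      _ = _ := by rw [← Finset.sum_mul, hsum, one_mul]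
  linarith

lemma relTrace_self {ι : Type} [Fintype ι] [DecidableEq ι] (ρ : Matrix ι ι ℂ) :
    relTrace ρ ρ = 0 := by
  simp [relTrace]

lemma relEnt_self {ι : Type} [Fintype ι] [DecidableEq ι] (ρ : Matrix ι ι ℂ) :
    relEnt ρ ρ = 0 := by
  rw [relEnt_of_suppLE fun _ => id, relTrace_self, EReal.coe_zero]

lemma relEnt_one_kronecker {ν μ : Matrix B B ℂ} (hν : IsDensity ν) (hμ : IsDensity μ) :
    relEnt ((1 : Matrix (Fin 1) (Fin 1) ℂ) ⊗ₖ ν) ((1 : Matrix (Fin 1) (Fin 1) ℂ) ⊗ₖ μ) =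
      relEnt ν μ := by
  by_cases h : suppLE ν μ
  · rw [relEnt_of_suppLE h, relEnt_of_suppLE (suppLE_kronecker .one .one hν.1 hμ.1 (fun _ => id) h),
      relTrace_kronecker .one .one hν.1 hμ.1 (fun _ => id) h, relTrace_self]
    simp
  · rw [relEnt_of_not_suppLE h, relEnt_of_not_suppLE]
    contrapose! h
    have key : ∀ (A : Matrix B B ℂ) (v : B → ℂ) (k : Fin 1 × B),
        (((1 : Matrix (Fin 1) (Fin 1) ℂ) ⊗ₖ A) *ᵥ fun k => v k.2) k = (A *ᵥ v) k.2 := by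
      intro A v k
      simp [mulVec, dotProduct, Fintype.sum_prod_type, one_apply, Subsingleton.elim k.1 0]
    intro v hv
    have h1 := h (fun k => v k.2) (funext fun k => by rw [key, hv]; rfl)
    funext b
    have h2 := congrFun h1 (0, b)
    rwa [key] at h2

lemma isDensity_single {ι : Type} [Fintype ι] [DecidableEq ι] (i : ι) :
    IsDensity (diagonal (Pi.single i (1 : ℂ))) := by
  refine ⟨PosSemidef.diagonal ?_, by simp⟩
  rw [Pi.single_nonneg]
  exact zero_le_one

omit [DecidableEq B] in
lemma idTensor_cqChannel_single (ν : X → Matrix B B ℂ) (x : X) :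
    idTensor (cqChannel ν) (diagonal (Pi.single ((0 : Fin 1), x) (1 : ℂ))) =
      (1 : Matrix (Fin 1) (Fin 1) ℂ) ⊗ₖ ν x := by
  ext ⟨i, a⟩ ⟨j, b⟩
  obtain rfl := Subsingleton.elim i 0
  obtain rfl := Subsingleton.elim j 0
  simp only [idTensor, cqChannel, Matrix.sum_apply]
  rw [Finset.sum_eq_single x]
  · simp
  · intro y _ hy
    simp [hy]
  · simp

lemma le_amortizedDiv_relEnt_cqChannel {ν μ : X → Matrix B B ℂ}
    (hν : ∀ x, IsDensity (ν x)) (hμ : ∀ x, IsDensity (μ x)) :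
    ⨆ x, relEnt (ν x) (μ x) ≤ amortizedDiv relEntFam (cqChannel ν) (cqChannel μ) := by
  refine iSup_le fun x => ?_
  set ω : Matrix (Fin 1 × X) (Fin 1 × X) ℂ := diagonal (Pi.single (0, x) 1) with hω_def
  have hω : IsDensity ω := isDensity_single _
  refine le_iSup_of_le 1 (le_iSup_of_le ω (le_iSup_of_le ω
    (le_iSup_of_le hω (le_iSup_of_le hω ?_))))
  change _ ≤ relEnt (idTensor (cqChannel ν) ω) (idTensor (cqChannel μ) ω) - relEnt ω ω
  rw [relEnt_self, sub_zero, hω_def, idTensor_cqChannel_single, idTensor_cqChannel_single,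
    relEnt_one_kronecker (hν x) (hμ x)]

end Amortization

/-- Amortization collapse of the quantum relative entropy for
classical-quantum channels: `D^𝒜(N‖M) = max_x D(ν^x‖μ^x)`. -/
theorem cq_relEnt_amortization_collapse
    {X B : Type} [Fintype X] [DecidableEq X] [Nonempty X] [Fintype B] [DecidableEq B]
    (ν μ : X → Matrix B B ℂ) (hν : ∀ x, IsDensity (ν x)) (hμ : ∀ x, IsDensity (μ x)) :
    amortizedDiv relEntFam (cqChannel ν) (cqChannel μ) = ⨆ x, relEnt (ν x) (μ x) := by
  exact le_antisymm (amortizedDiv_relEnt_cqChannel_le hν hμ)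
    (le_amortizedDiv_relEnt_cqChannel hν hμ)

end
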